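/- arXiv:0803.1359 — 2 statements merged into one kernel-verified Lean document; each statement's English description precedes it below -/
import Mathlib

section
/- Let γ be the standard Gaussian measure on ℝ^N, let A : ℝ^N → ℝ^N be a linear map and c ∈ ℝ. Then for every q with 1 ≤ q ≤ 2, (∫ |⟨Aw, w⟩ − c|^q dγ(w))^{1/q} ≤ √2 · ‖A^sym‖_{HS} + |tr A − c|, where A^sym = (A + Aᵀ)/2 and ‖·‖_{HS} is the Hilbert–Schmidt norm. -/
open MeasureTheory ProbabilityTheory Real Matrix

/-- The standard Gaussian measure on `ℝ^N`. -/
noncomputable def stdGaussian (N : ℕ) : Measure (Fin N → ℝ) :=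
  Measure.pi fun _ => gaussianReal 0 1

lemma half_eq (N) (A : Matrix (Fin N) (Fin N) ℝ) : (((A + Aᵀ) / 2))  = (1/2:ℝ)•(A+Aᵀ) := by
  rw [div_eq_mul_inv]
  have : (2:Matrix (Fin N) (Fin N) ℝ)⁻¹ = (1/2:ℝ)•1 := by
    apply Matrix.inv_eq_right_inv
    have h2 : (2:Matrix (Fin N) (Fin N) ℝ) = (2:ℝ) • 1 := by
      rw [two_smul, one_add_one_eq_two]
    rw [Matrix.mul_smul, mul_one, h2, smul_smul]
    norm_num
  simp [this]

lemma memLp_sq : MemLp (fun x : ℝ => x ^ 2) 2 (gaussianReal 0 1) := by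
  have h := memLp_id_gaussianReal' (μ := 0) (v := 1) 4 (by norm_num)
  rw [memLp_two_iff_integrable_sq (by fun_prop)]
  have := h.integrable_norm_pow (p := 4) (by norm_num)
  refine this.congr (Filter.Eventually.of_forall fun x => ?_)
  simp only [id, Real.norm_eq_abs]
  rw [← pow_mul]
  exact Even.pow_abs (by decide) x

lemma int_sq : ∫ x, x ^ 2 ∂(gaussianReal 0 1) = 1 := by
  have h := variance_id_gaussianReal (μ := 0) (v := 1)
  rw [variance_eq_sub (memLp_id_gaussianReal' 2 (by norm_num))] at h
  simpa using h

lemma int_four : ∫ x, x ^ 4 ∂(gaussianReal 0 1) = 3 := by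
  have h : ∫ x, x ^ 4 ∂(gaussianReal 0 1) = iteratedDeriv 4 (mgf id (gaussianReal 0 1)) 0 := by
    rw [iteratedDeriv_mgf_zero] <;> simp
  rw [h, mgf_id_gaussianReal]
  have d (p p' : ℝ → ℝ) (hp : ∀ t, HasDerivAt p (p' t) t) :
      deriv (fun t => p t * Real.exp (t^2/2)) = fun t => (p' t + t * p t) * Real.exp (t^2/2) := by
    ext t
    have h2 : HasDerivAt (fun t : ℝ => Real.exp (t^2/2)) (Real.exp (t^2/2) * t) t := by
      have := (((hasDerivAt_id' t).fun_pow 2).div_const 2).exp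
      convert this using 1
      norm_num
    rw [((hp t).fun_mul h2).deriv]; ring
  have e0 : (fun t : ℝ => Real.exp (0 * t + ((1 : NNReal):ℝ) * t ^ 2 / 2)) = fun t => (fun _ => 1) t * Real.exp (t^2/2) := by
    ext t; simp
  rw [e0]
  simp only [iteratedDeriv_succ', iteratedDeriv_zero]
  rw [d _ (fun _ => 0) (fun t => hasDerivAt_const t 1)]
  rw [d _ (fun _ => 1) (fun t => by simpa using hasDerivAt_id' t)]
  rw [d _ (fun t => 2 * t) (fun t => by
    have := ((hasDerivAt_id' t).fun_pow 2).const_add 1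
    have e : (fun t : ℝ => 1 + t * (0 + t * 1)) = fun x => 1 + x ^ 2 := by
      ext s; ring
    rw [e]
    exact this.congr_deriv (by norm_num))]
  rw [d _ (fun t => 3 + 3 * t^2) (fun t => by
    have := ((hasDerivAt_id' t).const_mul 3).fun_add ((hasDerivAt_id' t).fun_pow 3)
    have e : (fun t : ℝ => 2 * t + t * (1 + t * (0 + t * 1))) = fun x => 3 * x + x ^ 3 := by
      ext s; ring
    rw [e]
    exact this.congr_deriv (by norm_num))]
  simp

lemma var_sq : Var[fun x => x ^ 2; gaussianReal 0 1] = 2 := by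
  rw [variance_eq_sub memLp_sq, int_sq]
  have : ∀ x : ℝ, ((fun x : ℝ => x ^ 2) ^ 2) x = x ^ 4 := fun x => by simp; ring
  simp_rw [this, int_four]; norm_num

lemma diag_L2 (N : ℕ) (l : Fin N → ℝ) (c : ℝ) :
    MemLp (fun w : Fin N → ℝ => ∑ i, l i * w i ^ 2 - c) 2 (Measure.pi fun _ => gaussianReal 0 1) ∧
    ∫ w : Fin N → ℝ, (∑ i, l i * w i ^ 2 - c) ^ 2 ∂(Measure.pi fun _ => gaussianReal 0 1)
      = 2 * ∑ i, l i ^ 2 + (∑ i, l i - c) ^ 2 := by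
  have hm : ∀ i, MemLp (fun w : Fin N → ℝ => l i * w i ^ 2) 2 (Measure.pi fun _ => gaussianReal 0 1) := fun i =>
    (memLp_sq.const_mul (l i)).comp_measurePreserving (measurePreserving_eval (fun _ : Fin N => gaussianReal 0 1) i)
  have hS : MemLp (fun w : Fin N → ℝ => ∑ i, l i * w i ^ 2) 2 (Measure.pi fun _ => gaussianReal 0 1) :=
    memLp_finsetSum _ fun i _ => hm i
  have hX : MemLp (fun w : Fin N → ℝ => ∑ i, l i * w i ^ 2 - c) 2 (Measure.pi fun _ => gaussianReal 0 1) :=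
    hS.sub (memLp_const c)
  refine ⟨hX, ?_⟩
  have hv := variance_sum_pi (μ := fun _ : Fin N => gaussianReal 0 1) (X := fun i x => l i * x ^ 2)
    (fun i => memLp_sq.const_mul (l i))
  simp_rw [variance_const_mul, var_sq] at hv
  have hmean : ∫ w : Fin N → ℝ, ∑ i, l i * w i ^ 2 ∂(Measure.pi fun _ => gaussianReal 0 1) = ∑ i, l i := by
    rw [integral_finsetSum _ fun i _ => (hm i).integrable (by norm_num)]
    refine Finset.sum_congr rfl fun i _ => ?_
    rw [integral_comp_eval (μ := fun _ : Fin N => gaussianReal 0 1) (f := fun x => l i * x ^ 2) (by fun_prop),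
      integral_const_mul, int_sq, mul_one]
  have hf : (∑ i, fun w : Fin N → ℝ => l i * w i ^ 2) = fun w => ∑ i, l i * w i ^ 2 := by
    ext w; simp
  rw [hf] at hv
  have h2 := variance_eq_sub hX
  rw [variance_sub_const hS.aestronglyMeasurable, hv, integral_sub (hS.integrable (by norm_num)) (integrable_const c), hmean] at h2
  simp only [Pi.pow_apply, integral_const, probReal_univ, one_smul] at h2
  rw [Finset.mul_sum]
  simp_rw [mul_comm (2:ℝ)]
  linarith

lemma map_basis (N : ℕ) (b : OrthonormalBasis (Fin N) ℝ (EuclideanSpace ℝ (Fin N))) :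
    (Measure.pi fun _ : Fin N => gaussianReal 0 1).map (fun x : Fin N → ℝ => ∑ i, x i • (b i).ofLp)
      = Measure.pi fun _ : Fin N => gaussianReal 0 1 := by
  have h := ProbabilityTheory.stdGaussian_eq_map_pi_orthonormalBasis b
  rw [← map_pi_eq_stdGaussian] at h
  have h' := congrArg (Measure.map (WithLp.ofLp)) h
  rw [Measure.map_map (by fun_prop) (by fun_prop), Measure.map_map (by fun_prop) (by fun_prop)] at h'
  have e1 : (WithLp.ofLp ∘ WithLp.toLp 2 : (Fin N → ℝ) → _) = id := rfl
  rw [e1, Measure.map_id] at h'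
  have e2 : (WithLp.ofLp ∘ fun x : Fin N → ℝ => ∑ i, x i • b i) = fun x => ∑ i, x i • (b i).ofLp := by
    ext x j; simp
  rw [e2] at h'
  exact h'.symm

lemma quad_basis (N : ℕ) (S : Matrix (Fin N) (Fin N) ℝ) (hS : S.IsHermitian) (x : Fin N → ℝ) :
    (S *ᵥ (∑ i, x i • (hS.eigenvectorBasis i).ofLp)) ⬝ᵥ (∑ i, x i • (hS.eigenvectorBasis i).ofLp)
      = ∑ i, hS.eigenvalues i * x i ^ 2 := by
  have ho : ∀ i j, (hS.eigenvectorBasis i).ofLp ⬝ᵥ (hS.eigenvectorBasis j).ofLp = if i = j then 1 else 0 := by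
    intro i j
    have := orthonormal_iff_ite.mp hS.eigenvectorBasis.orthonormal j i
    rw [EuclideanSpace.inner_eq_star_dotProduct] at this
    simpa [eq_comm] using this
  rw [Matrix.mulVec_sum, sum_dotProduct]
  refine Finset.sum_congr rfl fun i _ => ?_
  rw [Matrix.mulVec_smul, hS.mulVec_eigenvectorBasis, dotProduct_sum]
  simp [ho, smul_dotProduct, dotProduct_smul]
  ring

lemma hs_eigen (N : ℕ) (S : Matrix (Fin N) (Fin N) ℝ) (hS : S.IsHermitian) :
    ∑ i, ∑ j, S i j ^ 2 = ∑ i, hS.eigenvalues i ^ 2 := by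
  have h1 : ∑ i, ∑ j, S i j ^ 2 = (S * S).trace := by
    simp only [Matrix.trace, Matrix.diag, Matrix.mul_apply]
    refine Finset.sum_congr rfl fun i _ => Finset.sum_congr rfl fun j _ => ?_
    have := hS.apply i j
    simp at this
    rw [this, sq]
  rw [h1]
  conv_lhs => rw [hS.spectral_theorem, ← map_mul, Unitary.conjStarAlgAut_apply, Matrix.trace_mul_comm,
    ← mul_assoc, Unitary.coe_star_mul_self, one_mul, Matrix.diagonal_mul_diagonal, Matrix.trace_diagonal]
  simp [sq]

lemma quad_sym (N : ℕ) (A : Matrix (Fin N) (Fin N) ℝ) (w : Fin N → ℝ) :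
    (A *ᵥ w) ⬝ᵥ w = (((1/2:ℝ) • (A + Aᵀ)) *ᵥ w) ⬝ᵥ w := by
  have : (Aᵀ *ᵥ w) ⬝ᵥ w = (A *ᵥ w) ⬝ᵥ w := by
    rw [Matrix.mulVec_transpose, ← Matrix.dotProduct_mulVec, dotProduct_comm]
  rw [Matrix.smul_mulVec, Matrix.add_mulVec, smul_dotProduct, add_dotProduct, this]
  simp; ring

lemma quad_L2 (N : ℕ) (A : Matrix (Fin N) (Fin N) ℝ) (c : ℝ) :
    MemLp (fun w : Fin N → ℝ => (A *ᵥ w) ⬝ᵥ w - c) 2 (Measure.pi fun _ => gaussianReal 0 1) ∧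
    ∫ w : Fin N → ℝ, ((A *ᵥ w) ⬝ᵥ w - c) ^ 2 ∂(Measure.pi fun _ => gaussianReal 0 1)
      = 2 * ∑ i, ∑ j, (((A + Aᵀ) / 2) i j) ^ 2 + (A.trace - c) ^ 2 := by
  rw [half_eq]
  simp_rw [quad_sym N A]
  have ht : A.trace = ((1/2:ℝ) • (A + Aᵀ)).trace := by
    simp; ring
  have hS : ((1/2:ℝ) • (A + Aᵀ)).IsHermitian := by
    ext i j; simp; ring
  rw [ht]
  generalize (1/2:ℝ) • (A + Aᵀ) = S at hS
  rw [hs_eigen N S hS, hS.trace_eq_sum_eigenvalues]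
  have hd := diag_L2 N hS.eigenvalues c
  have hmeas : Measurable (fun x : Fin N → ℝ => ∑ i, x i • (hS.eigenvectorBasis i).ofLp) := by fun_prop
  have hc : Continuous (fun w : Fin N → ℝ => (S *ᵥ w) ⬝ᵥ w - c) := by
    unfold Matrix.mulVec dotProduct; fun_prop
  simp_rw [← quad_basis N S hS] at hd
  have hmap := map_basis N hS.eigenvectorBasis
  constructor
  · rw [← hmap, memLp_map_measure_iff hc.aestronglyMeasurable hmeas.aemeasurable]
    exact hd.1
  · rw [← hmap, integral_map hmeas.aemeasurable (Continuous.aestronglyMeasurable (by fun_prop))]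
    exact hd.2

theorem stmt_1 (N : ℕ) (A : Matrix (Fin N) (Fin N) ℝ) (c : ℝ) (q : ℝ)
    (hq1 : 1 ≤ q) (hq2 : q ≤ 2) :
    (∫ w, |(A.mulVec w) ⬝ᵥ w - c| ^ q ∂(stdGaussian N)) ^ (1 / q)
      ≤ Real.sqrt 2 * Real.sqrt (∑ i, ∑ j, (((A + Aᵀ) / 2) i j) ^ 2)
        + |A.trace - c| := by
  unfold _root_.stdGaussian
  obtain ⟨hm, hi⟩ := quad_L2 N A c
  have hq0 : 0 < q := by linarith
  have hle : ENNReal.ofReal q ≤ 2 := by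
    rw [← ENNReal.ofReal_ofNat 2]; exact ENNReal.ofReal_le_ofReal hq2
  have key := eLpNorm_le_eLpNorm_of_exponent_le hle hm.aestronglyMeasurable
  rw [(hm.mono_exponent hle).eLpNorm_eq_integral_rpow_norm (by simpa using hq0) ENNReal.ofReal_ne_top,
    hm.eLpNorm_eq_integral_rpow_norm (by norm_num) (by norm_num),
    ENNReal.ofReal_le_ofReal_iff (by positivity), ENNReal.toReal_ofReal hq0.le] at key
  simp only [Real.norm_eq_abs, ENNReal.toReal_ofNat, Real.rpow_ofNat, sq_abs] at key
  rw [hi, ← one_div, ← one_div, ← Real.sqrt_eq_rpow] at key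
  refine key.trans ?_
  rw [← Real.sqrt_mul (by norm_num)]
  set s := ∑ i, ∑ j, (((A + Aᵀ) / 2) i j) ^ 2
  have hs : 0 ≤ 2 * s := by positivity
  rw [Real.sqrt_le_left (by positivity)]
  nlinarith [Real.sq_sqrt hs, sq_abs (A.trace - c), mul_nonneg (Real.sqrt_nonneg (2*s)) (abs_nonneg (A.trace - c))]
end

section
/- Gaussian integration by parts: let γ be a centered Gaussian measure on a separable Banach space E with Cameron–Martin space H and map j : E* → H. Then for every smooth cylindrical function φ and every e* ∈ E*, ∫_E ∂_{j(e*)} φ dγ = ∫_E φ(x) ⟨e*, x⟩ dγ(x). -/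
open MeasureTheory ProbabilityTheory

lemma stein_one_dim (v : NNReal) (hv : v ≠ 0) (f f' : ℝ → ℝ)
    (hd : ∀ t, HasDerivAt f (f' t) t) (hf' : Continuous f')
    (M : ℝ) (hM : ∀ t, ‖f t‖ ≤ M) (M' : ℝ) (hM' : ∀ t, ‖f' t‖ ≤ M') :
    ∫ t, (f t * t - v * f' t) ∂(gaussianReal 0 v) = 0 := by
  have hv' : (v : ℝ) ≠ 0 := by exact_mod_cast hv
  have hfc : Continuous f := continuous_iff_continuousAt.2 fun t => (hd t).continuousAt
  have hid : Integrable (fun t : ℝ => t) (gaussianReal 0 v) := by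
    exact IsGaussian.integrable_dual (gaussianReal 0 v) (ContinuousLinearMap.id ℝ ℝ)
  have hG : Integrable (fun t => f t * t - v * f' t) (gaussianReal 0 v) := by
    refine Integrable.sub (hid.bdd_mul hfc.aestronglyMeasurable (Filter.Eventually.of_forall hM)) ?_
    refine Integrable.const_mul ?_ _
    exact Integrable.of_bound hf'.aestronglyMeasurable M' (Filter.Eventually.of_forall hM')
  have hF : Integrable (fun t => -(v : ℝ) * f t) (gaussianReal 0 v) :=
    (Integrable.of_bound hfc.aestronglyMeasurable M (Filter.Eventually.of_forall hM)).const_mul _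
  rw [integral_gaussianReal_eq_integral_smul hv]
  rw [gaussianReal_of_var_ne_zero _ hv, integrable_withDensity_iff_integrable_smul'
    (measurable_gaussianPDF _ _) (Filter.Eventually.of_forall fun _ => gaussianPDF_lt_top)] at hG hF
  simp only [toReal_gaussianPDF] at hG hF
  refine integral_eq_zero_of_hasDerivAt_of_integrable (fun t => ?_) hG hF
  have h1 : HasDerivAt (gaussianPDFReal 0 v) (gaussianPDFReal 0 v t * (-t / v)) t := by
    unfold gaussianPDFReal
    have h2 : HasDerivAt (fun x : ℝ => -(x - 0) ^ 2 / (2 * v)) (-t / v) t := by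
      have := ((((hasDerivAt_id t).sub_const 0).pow 2).neg).div_const (2 * (v : ℝ))
      convert! this using 1
      simp
      field_simp
    convert! (h2.exp).const_mul (√(2 * Real.pi * v))⁻¹ using 1
    ring
  convert! h1.mul ((hd t).const_mul (-(v : ℝ))) using 1
  simp only [smul_eq_mul]
  field_simp
  ring

lemma gaussian_ibp (E : Type*) [NormedAddCommGroup E] [NormedSpace ℝ E] [CompleteSpace E]
    [TopologicalSpace.SeparableSpace E] [MeasurableSpace E] [BorelSpace E]
    (γ : Measure E) [IsProbabilityMeasure γ]
    (hγ : ∀ L : E →L[ℝ] ℝ, ∃ v : NNReal, Measure.map L γ = gaussianReal 0 v)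
    (estar : E →L[ℝ] ℝ)
    (hint : Integrable (fun x => estar x • x) γ)
    (φ : E → ℝ) (hφ : ContDiff ℝ 1 φ) (M : ℝ) (hM : ∀ x, ‖φ x‖ ≤ M)
    (M' : ℝ) (hM' : ∀ x, ‖fderiv ℝ φ x‖ ≤ M') :
    ∫ x, fderiv ℝ φ x (∫ y, estar y • y ∂γ) ∂γ = ∫ x, φ x * estar x ∂γ := by
  have : SecondCountableTopology E := UniformSpace.secondCountable_of_separable E
  have hG : IsGaussian γ := isGaussian_of_map_eq_gaussianReal fun L => by
    obtain ⟨v, h⟩ := hγ L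
    exact ⟨0, v, h⟩
  have hmean : ∀ L : E →L[ℝ] ℝ, ∫ x, L x ∂γ = 0 := fun L => by
    obtain ⟨v, h⟩ := hγ L
    have := integral_map (μ := γ) (φ := L) (f := fun t : ℝ => t) (by fun_prop) (by fun_prop)
    rw [← this, h, integral_id_gaussianReal]
  have hL2 : ∀ L : E →L[ℝ] ℝ, MemLp L 2 γ := fun L => IsGaussian.memLp_dual γ L 2 (by simp)
  obtain ⟨v, hv⟩ := hγ estar
  set h := ∫ y, estar y • y ∂γ with hh
  have hLh : ∀ L : E →L[ℝ] ℝ, L h = ∫ y, estar y * L y ∂γ := fun L => by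
    rw [hh, ← ContinuousLinearMap.integral_comp_comm _ hint]
    simp
  have hcov : ∀ L : E →L[ℝ] ℝ, cov[estar, L; γ] = L h := fun L => by
    rw [covariance_eq_sub (hL2 _) (hL2 _), hmean, hLh]; simp
  by_cases hv0 : v = 0
  · have hae : ∀ᵐ x ∂γ, estar x = 0 := by
      have : ∀ᵐ t ∂(Measure.map estar γ), t = 0 := by
        rw [hv, hv0, gaussianReal_zero_var, ae_dirac_eq]
        simp
      exact ae_of_ae_map (by fun_prop) this
    have hz : h = 0 := by
      rw [hh]
      apply integral_eq_zero_of_ae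
      filter_upwards [hae] with x hx
      simp [hx]
    rw [hz]
    simp only [map_zero, integral_zero]
    symm
    apply integral_eq_zero_of_ae
    filter_upwards [hae] with x hx
    simp [hx]
  have hv0' : (v : ℝ) ≠ 0 := by exact_mod_cast hv0
  have hvar : estar h = v := by
    rw [← hcov estar, covariance_self (by fun_prop)]
    have := variance_map (μ := γ) (X := fun t : ℝ => t) (Y := estar) (by fun_prop) (by fun_prop)
    rw [hv, variance_fun_id_gaussianReal] at this
    exact this.symm
  let Y : E →L[ℝ] E := ContinuousLinearMap.id ℝ E - ((v : ℝ)⁻¹ • estar).smulRight h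
  have hY : ∀ x, Y x = x - ((v : ℝ)⁻¹ * estar x) • h := fun x => by simp [Y]
  have hlaw : HasGaussianLaw (fun x => (estar x, Y x)) γ := by
    constructor
    exact isGaussian_map (estar.prod Y)
  have hind : IndepFun estar Y γ := by
    refine hlaw.indepFun_of_covariance_strongDual fun L₁ L₂ => ?_
    have e1 : (L₁ ∘ estar : E → ℝ) = fun x => L₁ 1 * estar x := by
      ext x
      have := L₁.map_smul (estar x) 1
      simp only [smul_eq_mul, mul_one] at this
      simp [this, mul_comm]
    have e2 : (L₂ ∘ Y : E → ℝ) = (L₂.comp Y) := rfl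
    rw [e1, e2, covariance_const_mul_left, hcov]
    simp [hY, hvar, hv0']
  have hmap := (indepFun_iff_map_prod_eq_prod_map_map (by fun_prop) (by fun_prop)).1 hind
  rw [hv] at hmap
  have hdc : Continuous (fun x => fderiv ℝ φ x h) :=
    (hφ.continuous_fderiv one_ne_zero).clm_apply continuous_const
  have hbd : ∀ x, ‖fderiv ℝ φ x h‖ ≤ M' * ‖h‖ := fun x =>
    (ContinuousLinearMap.le_opNorm _ _).trans (by gcongr; exact hM' x)
  have hi1 : Integrable (fun x => φ x * estar x) γ :=
    (IsGaussian.integrable_dual γ estar).bdd_mul hφ.continuous.aestronglyMeasurable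
      (Filter.Eventually.of_forall hM)
  have hi2 : Integrable (fun x => fderiv ℝ φ x h) γ :=
    Integrable.of_bound hdc.aestronglyMeasurable _ (Filter.Eventually.of_forall hbd)
  let G : ℝ × E → ℝ := fun p =>
    φ (p.2 + ((v : ℝ)⁻¹ * p.1) • h) * p.1 - fderiv ℝ φ (p.2 + ((v : ℝ)⁻¹ * p.1) • h) h
  have hGc : Continuous G := by
    have := hφ.continuous
    refine Continuous.sub (by fun_prop) (hdc.comp (by fun_prop))
  have hGe : ∀ x, G (estar x, Y x) = φ x * estar x - fderiv ℝ φ x h := fun x => by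
    simp [G, hY]
  have hpm : AEMeasurable (fun x => (estar x, Y x)) γ := by fun_prop
  have hGi : Integrable G (Measure.map (fun x => (estar x, Y x)) γ) := by
    rw [integrable_map_measure hGc.aestronglyMeasurable hpm]
    exact (hi1.sub hi2).congr (Filter.Eventually.of_forall fun x => (hGe x).symm)
  have key : ∫ x, (φ x * estar x - fderiv ℝ φ x h) ∂γ = 0 := by
    simp_rw [← hGe]
    rw [← integral_map hpm hGc.aestronglyMeasurable]
    rw [hmap] at hGi ⊢
    have : IsProbabilityMeasure (Measure.map Y γ) := Measure.isProbabilityMeasure_map (by fun_prop)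
    rw [integral_prod_symm _ hGi]
    apply integral_eq_zero_of_ae
    refine Filter.Eventually.of_forall fun y => ?_
    have := stein_one_dim v hv0 (fun t => φ (y + ((v : ℝ)⁻¹ * t) • h))
      (fun t => (v : ℝ)⁻¹ * fderiv ℝ φ (y + ((v : ℝ)⁻¹ * t) • h) h) (fun t => ?_)
      (continuous_const.mul (hdc.comp (by fun_prop))) M (fun t => hM _)
      ((v : ℝ)⁻¹ * (M' * ‖h‖)) (fun t => ?_)
    · simpa [G, hv0'] using this
    · have h1 : HasDerivAt (fun t : ℝ => y + ((v : ℝ)⁻¹ * t) • h) ((v : ℝ)⁻¹ • h) t := by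
        have := ((((hasDerivAt_id t).const_mul (v : ℝ)⁻¹).smul_const h).const_add y)
        simpa using this
      have h2 := (hφ.differentiable one_ne_zero
        (y + ((v : ℝ)⁻¹ * t) • h)).hasFDerivAt.comp_hasDerivAt t h1
      simpa using! h2
    · rw [norm_mul, Real.norm_of_nonneg (by positivity : (0 : ℝ) ≤ (v : ℝ)⁻¹)]
      gcongr
      exact hbd _
  rw [integral_sub hi1 hi2] at key
  linarith

theorem stmt_13 (E : Type*) [NormedAddCommGroup E] [NormedSpace ℝ E] [CompleteSpace E]
    [TopologicalSpace.SeparableSpace E] [MeasurableSpace E] [BorelSpace E]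
    (γ : Measure E) [IsProbabilityMeasure γ]
    -- γ is a centered Gaussian measure: every continuous linear functional is
    -- centered Gaussian distributed
    (hγ : ∀ L : E →L[ℝ] ℝ, ∃ v : NNReal, Measure.map L γ = gaussianReal 0 v)
    (estar : E →L[ℝ] ℝ)
    (hint : Integrable (fun x => estar x • x) γ)
    -- a smooth cylindrical function φ = ψ(⟨e₁*,x⟩,…,⟨e_N*,x⟩), ψ ∈ C_b^∞
    (N : ℕ) (ψ : (Fin N → ℝ) → ℝ) (e' : Fin N → E →L[ℝ] ℝ)
    (hψ : ContDiff ℝ (⊤ : ℕ∞) ψ)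
    (hψb : ∀ n : ℕ, ∃ M, ∀ z, ‖iteratedFDeriv ℝ n ψ z‖ ≤ M)
    (φ : E → ℝ) (hφ : φ = fun x => ψ (fun i => e' i x)) :
    -- `j(e*) = ∫ ⟨e*,x⟩ x dγ(x)` is the Cameron–Martin vector associated to `e*`
    ∫ x, fderiv ℝ φ x (∫ y, estar y • y ∂γ) ∂γ = ∫ x, φ x * estar x ∂γ := by
  let A : E →L[ℝ] (Fin N → ℝ) := ContinuousLinearMap.pi e'
  have hφA : φ = ψ ∘ A := by rw [hφ]; rfl
  have hψ1 : ContDiff ℝ 1 ψ := hψ.of_le (by exact_mod_cast le_top)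
  obtain ⟨M0, h0⟩ := hψb 0
  obtain ⟨M1, h1⟩ := hψb 1
  simp only [norm_iteratedFDeriv_zero] at h0
  simp only [norm_iteratedFDeriv_one] at h1
  refine gaussian_ibp E γ hγ estar hint φ (hφA ▸ hψ1.comp A.contDiff) M0
    (fun x => by rw [hφA]; exact h0 _) (M1 * ‖A‖) fun x => ?_
  rw [hφA, fderiv_comp x (hψ1.differentiable one_ne_zero _) A.differentiableAt, A.fderiv]
  refine (ContinuousLinearMap.opNorm_comp_le _ _).trans ?_
  gcongr
  exact h1 _
end
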